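/- Let C be an n×n real symmetric positive definite matrix, F an n×n_p real matrix of rank n_p, and β ≥ 0. Set Z = C⁻¹ F, Ĉ = C + β F Fᵀ, E = Zᵀ Ĉ Z, and P = Z E⁻¹ Zᵀ Ĉ. Then Fᵀ P = Fᵀ; consequently, for every w ∈ ℝⁿ one has Fᵀ (I − P) w = 0 and hence Ĉ (I − P) w = C (I − P) w. -/

import Mathlib

open Matrix

/-- A matrix whose rank equals its number of columns has injective `mulVec`. -/
lemma Matrix.mulVec_injective_of_rank_eq_card {m n K : Type*} [Finite m] [Fintype n] [Field K]
    {A : Matrix m n K} (hA : A.rank = Fintype.card n) : Function.Injective A.mulVec := by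
  rw [mulVec_injective_iff, linearIndependent_iff_card_eq_finrank_span, ← hA,
    rank_eq_finrank_span_cols, Set.finrank]

/-- Equation (u_M_left): `Fᵀ P = Fᵀ`, hence `Fᵀ (I − P) w = 0` and
`Ĉ (I − P) w = C (I − P) w` for every `w`. -/
theorem complementary_component
    (n np : ℕ)
    (C : Matrix (Fin n) (Fin n) ℝ) (hC : C.PosDef)
    (F : Matrix (Fin n) (Fin np) ℝ) (hF : F.rank = np)
    (β : ℝ) (hβ : 0 ≤ β)
    (Z : Matrix (Fin n) (Fin np) ℝ) (hZ : Z = C⁻¹ * F)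
    (Chat : Matrix (Fin n) (Fin n) ℝ) (hChat : Chat = C + β • (F * Fᵀ))
    (E : Matrix (Fin np) (Fin np) ℝ) (hE : E = Zᵀ * Chat * Z)
    (P : Matrix (Fin n) (Fin n) ℝ) (hP : P = Z * E⁻¹ * Zᵀ * Chat) :
    Fᵀ * P = Fᵀ ∧
    (∀ w : Fin n → ℝ,
      Fᵀ *ᵥ ((1 - P) *ᵥ w) = 0 ∧
      Chat *ᵥ ((1 - P) *ᵥ w) = C *ᵥ ((1 - P) *ᵥ w)) := by
  have hCdet : IsUnit C.det := (isUnit_iff_isUnit_det C).1 hC.isUnit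
  have hG : (Fᵀ * Z).PosDef := by
    have hinj : Function.Injective F.mulVec := mulVec_injective_of_rank_eq_card (by simpa using hF)
    simpa [hZ, Matrix.mul_assoc] using hC.inv.conjTranspose_mul_mul_same hinj
  have hA : (1 + β • (Fᵀ * Z)).PosDef := PosDef.one.add_posSemidef (hG.posSemidef.smul hβ)
  have hZChat : Zᵀ * Chat = (1 + β • (Fᵀ * Z)) * Fᵀ := by
    have hCt : Cᵀ = C := by simpa using hC.isHermitian.eq
    rw [hZ, hChat, transpose_mul, transpose_nonsing_inv, hCt, Matrix.mul_add,
      nonsing_inv_mul_cancel_right _ _ hCdet]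
    simp [Matrix.add_mul, Matrix.mul_assoc]
  have hFP : Fᵀ * P = Fᵀ := by
    have hGdet := (isUnit_iff_isUnit_det _).1 hG.isUnit
    have hAdet := (isUnit_iff_isUnit_det _).1 hA.isUnit
    calc Fᵀ * P = (Fᵀ * Z) * E⁻¹ * (Zᵀ * Chat) := by simp only [hP, Matrix.mul_assoc]
      _ = Fᵀ := by
        rw [hE, hZChat, Matrix.mul_assoc _ Fᵀ Z, Matrix.mul_inv_rev,
          mul_nonsing_inv_cancel_left _ _ hGdet, nonsing_inv_mul_cancel_left _ _ hAdet]
  have hker (w : Fin n → ℝ) : Fᵀ *ᵥ ((1 - P) *ᵥ w) = 0 := by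
    rw [mulVec_mulVec, Matrix.mul_sub, Matrix.mul_one, hFP, sub_self, zero_mulVec]
  refine ⟨hFP, fun w ↦ ⟨hker w, ?_⟩⟩
  rw [hChat, add_mulVec, smul_mulVec, ← mulVec_mulVec _ F Fᵀ, hker, mulVec_zero, smul_zero,
    add_zero]
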